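/- Let s₁, s₂ be natural numbers, 0 ≤ α₁, α₂ ≤ 1, η₁, η₂ > 0, γ₁, γ₂ > 0, and let φ : [0,1]² → ℝ be continuous. Then the bivariate operators converge uniformly to φ on [0,1]²: for every ε > 0 there exists N with N ≥ max(s₁, s₂, 1) such that for all m₁, m₂ ≥ N and all (z,y) ∈ [0,1]², |ℜ_{m₁,m₂,η₁,η₂,γ₁,γ₂}^{(α₁,α₂,s₁,s₂)}(φ; z, y) − φ(z,y)| < ε. -/

import Mathlib

open Real MeasureTheory Finset Set

/-- Generalized blending Bernstein basis functions `q_{m,j}^{(α,s)}(z)`. -/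
noncomputable def qbasis (m s : ℕ) (α : ℝ) (z : ℝ) (j : ℕ) : ℝ :=
  if j < s then
    (m.choose j : ℝ) * z ^ j * (1 - z) ^ (m - j)
  else
    (1 - α) * ((m - s).choose (j - s) : ℝ) * z ^ (j - s + 1) * (1 - z) ^ (m - j)
      + (1 - α) * ((m - s).choose j : ℝ) * z ^ j * (1 - z) ^ (m - s - j + 1)
      + α * (m.choose j : ℝ) * z ^ j * (1 - z) ^ (m - j)

/-- Bivariate Riemann–Liouville type fractional generalized Bernstein–Kantorovich operator. -/
noncomputable def Rop₂ (m₁ m₂ s₁ s₂ : ℕ) (α₁ α₂ η₁ η₂ γ₁ γ₂ : ℝ)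
    (φ : ℝ → ℝ → ℝ) (z y : ℝ) : ℝ :=
  Real.Gamma (η₁ + 1) * Real.Gamma (η₂ + 1) *
    ∑ j₁ ∈ Finset.range (m₁ + 1), ∑ j₂ ∈ Finset.range (m₂ + 1),
      qbasis m₁ s₁ α₁ z j₁ * qbasis m₂ s₂ α₂ y j₂ *
        ∫ t₁ in (0:ℝ)..1, ∫ t₂ in (0:ℝ)..1,
          ((1 - t₁) ^ (η₁ - 1) / Real.Gamma η₁) * ((1 - t₂) ^ (η₂ - 1) / Real.Gamma η₂) *
            φ (((j₁ : ℝ) + t₁ ^ γ₁) / (m₁ + 1)) (((j₂ : ℝ) + t₂ ^ γ₂) / (m₂ + 1))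

/-- Bernstein weights. -/
noncomputable def bw (n j : ℕ) (z : ℝ) : ℝ := (n.choose j : ℝ) * z ^ j * (1 - z) ^ (n - j)

lemma bw_nonneg (n j : ℕ) {z : ℝ} (hz : z ∈ Set.Icc (0:ℝ) 1) : 0 ≤ bw n j z := by
  have h0 := hz.1
  have h1 : 0 ≤ 1 - z := by linarith [hz.2]
  unfold bw; positivity

lemma bw_zero_of_lt {n j : ℕ} (h : n < j) (z : ℝ) : bw n j z = 0 := by
  simp [bw, Nat.choose_eq_zero_of_lt h]

lemma bw_eval (n j : ℕ) (z : ℝ) : (bernsteinPolynomial ℝ n j).eval z = bw n j z := by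
  simp [bernsteinPolynomial, bw]

lemma bw_sum (n : ℕ) (z : ℝ) : ∑ j ∈ Finset.range (n + 1), bw n j z = 1 := by
  have h := congrArg (Polynomial.eval z) (bernsteinPolynomial.sum ℝ n)
  simpa [Polynomial.eval_finsetSum, bw_eval] using h

lemma bw_sum_ext (n s : ℕ) (z : ℝ) (g : ℕ → ℝ) :
    ∑ j ∈ Finset.range (n + 1 + s), bw n j z * g j
      = ∑ j ∈ Finset.range (n + 1), bw n j z * g j := by
  rw [Finset.sum_range_add]
  simp only [add_eq_left]
  apply Finset.sum_eq_zero
  intro i _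
  rw [bw_zero_of_lt (by omega), zero_mul]

lemma bw_var (n : ℕ) (z : ℝ) :
    ∑ j ∈ Finset.range (n + 1), bw n j z * ((j:ℝ) - n * z) ^ 2 = n * z * (1 - z) := by
  have h := congrArg (Polynomial.eval z) (bernsteinPolynomial.variance ℝ n)
  simp [Polynomial.eval_finsetSum, bw_eval] at h
  rw [← h]
  apply Finset.sum_congr rfl
  intros; ring

lemma bw_le_one (n j : ℕ) {z : ℝ} (hz : z ∈ Set.Icc (0:ℝ) 1) : bw n j z ≤ 1 := by
  by_cases h : n < j
  · rw [bw_zero_of_lt h]; norm_num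
  · rw [← bw_sum n z]
    exact Finset.single_le_sum (f := fun j => bw n j z) (fun i _ => bw_nonneg n i hz)
      (by simp; omega)

lemma z_bw (n j : ℕ) (z : ℝ) : ((n:ℝ) + 1) * (z * bw n j z) = (j + 1) * bw (n+1) (j+1) z := by
  have h : (((n + 1) * n.choose j : ℕ) : ℝ) = ((n+1).choose (j+1) * (j+1) : ℕ) := by
    rw [Nat.add_one_mul_choose_eq]
  push_cast at h
  unfold bw
  rw [Nat.add_sub_add_right]
  linear_combination z^(j+1) * (1-z)^(n-j) * h

lemma z_bw_le (n j : ℕ) {z : ℝ} (hz : z ∈ Set.Icc (0:ℝ) 1) :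
    z * bw n j z ≤ (j + 1) / (n + 1) := by
  rw [le_div_iff₀ (by positivity), mul_comm, z_bw]
  have := bw_le_one (n+1) (j+1) hz
  have h2 : (0:ℝ) ≤ j + 1 := by positivity
  nlinarith

lemma bw_rec (n j : ℕ) (z : ℝ) :
    bw (n+1) (j+1) z = (1 - z) * bw n (j+1) z + z * bw n j z := by
  unfold bw
  rw [Nat.choose_succ_succ, Nat.add_sub_add_right]
  rcases Nat.lt_or_ge j n with h | h
  · have : n - j = (n - (j+1)) + 1 := by omega
    rw [this]; push_cast; ring
  · rw [Nat.choose_eq_zero_of_lt (show n < j + 1 by omega)]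
    push_cast; ring

lemma bw_step (n j : ℕ) {z : ℝ} (hz : z ∈ Set.Icc (0:ℝ) 1) :
    |bw (n+1) j z - bw n j z| ≤ (j + 1) / (n + 1) := by
  have hz0 := hz.1
  cases j with
  | zero =>
    have h : bw (n+1) 0 z = (1 - z) * bw n 0 z := by simp [bw]; ring
    have h1 := z_bw_le n 0 hz
    have h2 := mul_nonneg hz0 (bw_nonneg n 0 hz)
    rw [h, abs_le]; constructor <;> nlinarith
  | succ j =>
    rw [bw_rec]
    have h1 := z_bw_le n (j+1) hz
    have h2 := mul_nonneg hz0 (bw_nonneg n (j+1) hz)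
    have h3 := z_bw_le n j hz
    have h4 := mul_nonneg hz0 (bw_nonneg n j hz)
    have h5 : ((j:ℝ) + 1) / (n+1) ≤ (((j+1:ℕ):ℝ) + 1) / (n+1) := by
      push_cast; gcongr; linarith
    rw [abs_le]; constructor <;> nlinarith

lemma bw_steps (n j k : ℕ) {z : ℝ} (hz : z ∈ Set.Icc (0:ℝ) 1) :
    |bw (n+k) j z - bw n j z| ≤ k * ((j + 1) / (n + 1)) := by
  induction k with
  | zero => simp
  | succ k ih =>
    have h := bw_step (n+k) j hz
    have h2 : ((j:ℝ) + 1) / ((n+k:ℕ) + 1) ≤ (j+1)/(n+1) := by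
      push_cast; gcongr; linarith [(Nat.cast_nonneg k : (0:ℝ) ≤ k)]
    rw [← add_assoc]
    have h3 := abs_sub_le (bw (n+k+1) j z) (bw (n+k) j z) (bw n j z)
    push_cast at *
    linarith

lemma q_lt {n s j : ℕ} (α z : ℝ) (h : j < s) : qbasis (n+s) s α z j = bw (n+s) j z := by
  simp [qbasis, h, bw]

lemma q_ge (n s i : ℕ) (α z : ℝ) : qbasis (n+s) s α z (s+i) =
    (1-α) * (z * bw n i z) + (1-α) * ((1-z) * bw n (s+i) z) + α * bw (n+s) (s+i) z := by
  have e1 : n + s - (s+i) = n - i := by omega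
  simp only [qbasis, bw, if_neg (show ¬ s + i < s by omega), Nat.add_sub_cancel_left,
    Nat.add_sub_cancel, e1]
  ring

lemma q_nonneg (n s j : ℕ) {α z : ℝ} (h0 : 0 ≤ α) (h1 : α ≤ 1) (hz : z ∈ Set.Icc (0:ℝ) 1) :
    0 ≤ qbasis (n+s) s α z j := by
  rcases Nat.lt_or_ge j s with h | h
  · rw [q_lt _ _ h]; exact bw_nonneg _ _ hz
  · obtain ⟨i, rfl⟩ := Nat.exists_eq_add_of_le h
    rw [q_ge]
    have a := bw_nonneg n i hz
    have b := bw_nonneg n (s+i) hz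
    have c := bw_nonneg (n+s) (s+i) hz
    have d : 0 ≤ 1 - α := by linarith
    have e : 0 ≤ 1 - z := by linarith [hz.2]
    have := hz.1
    positivity

lemma q_sum (n s : ℕ) (α z : ℝ) : ∑ j ∈ Finset.range (n + s + 1), qbasis (n+s) s α z j
    = 1 + (1-α) * ∑ j ∈ Finset.range s, (bw (n+s) j z - (1-z) * bw n j z) := by
  have A := bw_sum (n+s) z
  have B := bw_sum_ext n s z (fun _ => 1)
  have C := bw_sum n z
  simp only [mul_one] at B
  rw [C, show n + 1 + s = s + (n+1) by ring, Finset.sum_range_add] at B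
  rw [show n + s + 1 = s + (n+1) by ring, Finset.sum_range_add] at A ⊢
  rw [Finset.sum_congr rfl (fun j hj => q_lt α z (Finset.mem_range.1 hj)),
    Finset.sum_congr rfl (fun i _ => q_ge n s i α z)]
  simp only [Finset.sum_add_distrib, Finset.sum_sub_distrib, ← Finset.mul_sum]
  rw [C]
  linear_combination α * A + (1-α)*(1-z) * B

lemma q_sum_sub_le (n s : ℕ) {α z : ℝ} (h0 : 0 ≤ α) (h1 : α ≤ 1) (hz : z ∈ Set.Icc (0:ℝ) 1) :
    |∑ j ∈ Finset.range (n + s + 1), qbasis (n+s) s α z j - 1|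
      ≤ (s * ((s+1) * (s+1))) / (n+1) := by
  rw [q_sum, add_sub_cancel_left, abs_mul, abs_of_nonneg (by linarith : 0 ≤ 1 - α)]
  have key : |∑ j ∈ Finset.range s, (bw (n+s) j z - (1-z) * bw n j z)|
      ≤ (s * ((s+1) * (s+1))) / (n+1) := by
    refine (Finset.abs_sum_le_sum_abs _ _).trans ?_
    have : ∀ j ∈ Finset.range s, |bw (n+s) j z - (1-z) * bw n j z|
        ≤ ((s:ℝ)+1) * (s+1) / (n+1) := by
      intro j hj
      have hj' : (j:ℝ) ≤ s := by exact_mod_cast (Finset.mem_range.1 hj).le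
      have a := bw_steps n j s hz
      have b := z_bw_le n j hz
      have c := mul_nonneg hz.1 (bw_nonneg n j hz)
      have e : ((s:ℝ)+1) * ((j+1)/(n+1)) ≤ ((s:ℝ)+1) * (s+1) / (n+1) := by
        rw [mul_div_assoc]; gcongr
      rw [abs_le] at a ⊢
      constructor <;> linarith [a.1, a.2]
    refine (Finset.sum_le_sum this).trans ?_
    simp [mul_div_assoc]
  have := abs_nonneg (∑ j ∈ Finset.range s, (bw (n+s) j z - (1-z) * bw n j z))
  nlinarith

lemma q_ge_le (n s i : ℕ) {α z : ℝ} (h0 : 0 ≤ α) (h1 : α ≤ 1) (hz : z ∈ Set.Icc (0:ℝ) 1) :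
    qbasis (n+s) s α z (s+i) ≤ bw n i z + bw n (s+i) z + bw (n+s) (s+i) z := by
  rw [q_ge]
  have a := bw_nonneg n i hz
  have b := bw_nonneg n (s+i) hz
  have c := bw_nonneg (n+s) (s+i) hz
  have l : (1-α) * z ≤ 1 := by nlinarith [hz.1, hz.2]
  have l2 : (1-α) * (1-z) ≤ 1 := by nlinarith [hz.1, hz.2]
  nlinarith [mul_le_mul_of_nonneg_right l a, mul_le_mul_of_nonneg_right l2 b,
    mul_le_mul_of_nonneg_right h1 c]

lemma bw_var_shift (n : ℕ) {z c : ℝ} (hz : z ∈ Set.Icc (0:ℝ) 1) :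
    ∑ j ∈ Finset.range (n + 1), bw n j z * ((j:ℝ) - n * z + c) ^ 2 ≤ 2 * n + 2 * c^2 := by
  have h : ∀ j ∈ Finset.range (n+1), bw n j z * ((j:ℝ) - n * z + c) ^ 2
      ≤ 2 * (bw n j z * ((j:ℝ) - n * z) ^ 2) + 2 * c^2 * bw n j z := by
    intro j _
    have := bw_nonneg n j hz
    nlinarith [mul_nonneg this (sq_nonneg ((j:ℝ) - n * z - c))]
  refine (Finset.sum_le_sum h).trans ?_
  rw [Finset.sum_add_distrib, ← Finset.mul_sum, ← Finset.mul_sum, bw_var, bw_sum]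
  have : z * (1-z) ≤ 1 := by nlinarith [hz.1, hz.2]
  have hn : (0:ℝ) ≤ n := Nat.cast_nonneg n
  nlinarith

lemma q_var (n s : ℕ) {α z : ℝ} (h0 : 0 ≤ α) (h1 : α ≤ 1) (hz : z ∈ Set.Icc (0:ℝ) 1) :
    ∑ j ∈ Finset.range (n + s + 1), qbasis (n+s) s α z j * ((j:ℝ) - ((n+s:ℕ):ℝ) * z)^2
      ≤ 6 * ((n+s:ℕ):ℝ) + 4 * s^2 := by
  set g : ℕ → ℝ := fun j => ((j:ℝ) - ((n+s:ℕ):ℝ) * z)^2 with hg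
  have g0 : ∀ j, 0 ≤ g j := fun j => sq_nonneg _
  have A : ∑ j ∈ Finset.range (n + s + 1), bw (n+s) j z * g j ≤ 2 * ((n+s:ℕ):ℝ) := by
    simpa [hg] using bw_var_shift (n+s) (c := 0) hz
  have hs : (0:ℝ) ≤ s := Nat.cast_nonneg s
  have B : ∑ j ∈ Finset.range (n + 1 + s), bw n j z * g j ≤ 2 * n + 2 * s^2 := by
    rw [bw_sum_ext]
    have := bw_var_shift n (c := -(s*z)) hz
    have e : (-(s*z))^2 ≤ (s:ℝ)^2 := by
      rw [neg_sq, mul_pow]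
      have : z^2 ≤ 1 := by nlinarith [hz.1, hz.2]
      nlinarith [sq_nonneg (s:ℝ)]
    refine le_trans (le_of_eq ?_) (this.trans (by linarith))
    apply Finset.sum_congr rfl
    intro j _; simp only [hg]; push_cast; ring
  have C : ∑ i ∈ Finset.range (n + 1), bw n i z * g (s+i) ≤ 2 * n + 2 * s^2 := by
    have := bw_var_shift n (c := s*(1-z)) hz
    have e : (s*(1-z))^2 ≤ (s:ℝ)^2 := by
      rw [mul_pow]
      have : (1-z)^2 ≤ 1 := by nlinarith [hz.1, hz.2]
      nlinarith [sq_nonneg (s:ℝ)]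
    refine le_trans (le_of_eq ?_) (this.trans (by linarith))
    apply Finset.sum_congr rfl
    intro j _; simp only [hg]; push_cast; ring
  change ∑ j ∈ Finset.range (n + s + 1), qbasis (n+s) s α z j * g j ≤ _
  rw [show n + 1 + s = s + (n+1) by ring, Finset.sum_range_add] at B
  rw [show n + s + 1 = s + (n+1) by ring, Finset.sum_range_add] at A ⊢
  have D : ∑ i ∈ Finset.range (n+1), qbasis (n+s) s α z (s+i) * g (s+i) ≤
      ∑ i ∈ Finset.range (n+1), (bw n i z * g (s+i) + bw n (s+i) z * g (s+i)
        + bw (n+s) (s+i) z * g (s+i)) := by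
    apply Finset.sum_le_sum
    intro i _
    rw [← add_mul, ← add_mul]
    exact mul_le_mul_of_nonneg_right (q_ge_le n s i h0 h1 hz) (g0 _)
  have E : ∑ i ∈ Finset.range s, qbasis (n+s) s α z i * g i =
      ∑ i ∈ Finset.range s, bw (n+s) i z * g i :=
    Finset.sum_congr rfl (fun j hj => by rw [q_lt α z (Finset.mem_range.1 hj)])
  have F : 0 ≤ ∑ i ∈ Finset.range s, bw n i z * g i :=
    Finset.sum_nonneg (fun i _ => mul_nonneg (bw_nonneg _ _ hz) (g0 _))
  rw [Finset.sum_add_distrib, Finset.sum_add_distrib] at D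
  push_cast at *
  linarith

/-- Uniform smallness of both the mass defect and the second moment. -/
lemma q_unif (s : ℕ) {α : ℝ} (h0 : 0 ≤ α) (h1 : α ≤ 1) {δ : ℝ} (hδ : 0 < δ) :
    ∃ N : ℕ, ∀ m, N ≤ m → ∀ z ∈ Set.Icc (0:ℝ) 1,
      (∀ j, 0 ≤ qbasis m s α z j) ∧
      |∑ j ∈ Finset.range (m + 1), qbasis m s α z j - 1| ≤ δ ∧
      ∑ j ∈ Finset.range (m + 1), qbasis m s α z j *
        (2 * ((j:ℝ) / m - z)^2 + 2 * (1 / (m:ℝ))^2) ≤ δ := by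
  set K : ℝ := s * ((s+1) * (s+1)) with hK
  have hK0 : 0 ≤ K := by positivity
  set L : ℝ := 2 * (6 + 4 * s^2) + 2 * (1 + K) with hL
  have hL0 : 0 ≤ L := by positivity
  obtain ⟨N, hN⟩ := exists_nat_gt ((K + L) / δ)
  rw [div_lt_iff₀ hδ] at hN
  refine ⟨N + s + 1, fun m hm z hz => ?_⟩
  obtain ⟨n, rfl⟩ : ∃ n, m = n + s := ⟨m - s, by omega⟩
  have hn : N + 1 ≤ n := by omega
  have hn' : (N:ℝ) + 1 ≤ n := by exact_mod_cast hn
  have hs : (0:ℝ) ≤ s := Nat.cast_nonneg s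
  have hN0 : (0:ℝ) ≤ N := Nat.cast_nonneg N
  have S := q_sum_sub_le n s h0 h1 hz
  rw [← hK] at S
  have V := q_var n s h0 h1 hz
  refine ⟨fun j => q_nonneg n s j h0 h1 hz, S.trans ?_, ?_⟩
  · rw [div_le_iff₀ (by positivity)]
    nlinarith
  · have S2 : ∑ j ∈ Finset.range (n + s + 1), qbasis (n+s) s α z j ≤ 1 + K := by
      have : K / (n+1) ≤ K := div_le_self hK0 (by linarith)
      linarith [(abs_le.1 S).2]
    set m : ℝ := ((n+s:ℕ):ℝ) with hm'
    have hm1 : (N:ℝ) + 1 ≤ m := by rw [hm']; push_cast; linarith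
    have hm0 : 0 < m := by linarith
    have e : ∑ j ∈ Finset.range (n + s + 1), qbasis (n+s) s α z j *
        (2 * ((j:ℝ) / m - z)^2 + 2 * (1 / m)^2) =
        (2 * ∑ j ∈ Finset.range (n + s + 1), qbasis (n+s) s α z j * ((j:ℝ) - m * z)^2
          + 2 * ∑ j ∈ Finset.range (n + s + 1), qbasis (n+s) s α z j) / m^2 := by
      rw [Finset.mul_sum, Finset.mul_sum, ← Finset.sum_add_distrib, Finset.sum_div]
      apply Finset.sum_congr rfl
      intro j _
      field_simp
    rw [e, div_le_iff₀ (by positivity)]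
    have h3 : 2 * (6 * m + 4 * s^2) + 2 * (1+K) ≤ L * m := by
      rw [hL]
      have : 0 ≤ 8 * (s:ℝ)^2 + 2 * (1+K) := by positivity
      nlinarith
    have h4 : L ≤ δ * m := by nlinarith
    nlinarith

lemma ker_int {η : ℝ} (hη : 0 < η) :
    IntervalIntegrable (fun t : ℝ => (1 - t) ^ (η - 1)) volume 0 1 := by
  have h := (intervalIntegral.intervalIntegrable_rpow' (a := 0) (b := 1) (r := η - 1)
    (by linarith)).comp_sub_left 1
  simpa using h.symm

lemma ker_val {η : ℝ} (hη : 0 < η) : η * ∫ t in (0:ℝ)..1, (1 - t) ^ (η - 1) = 1 := by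
  rw [intervalIntegral.integral_comp_sub_left (fun t : ℝ => t ^ (η - 1)) 1]
  rw [integral_rpow (Or.inl (by linarith))]
  simp [Real.zero_rpow hη.ne', hη.ne']

lemma ker_avg {η : ℝ} (hη : 0 < η) {g : ℝ → ℝ} (hg : Continuous g) {c C : ℝ}
    (h : ∀ t ∈ Set.Icc (0:ℝ) 1, |g t - c| ≤ C) :
    |η * (∫ t in (0:ℝ)..1, (1 - t) ^ (η - 1) * g t) - c| ≤ C := by
  have i1 := ker_int hη
  have i2 : IntervalIntegrable (fun t : ℝ => (1 - t) ^ (η - 1) * g t) volume 0 1 :=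
    i1.mul_continuousOn hg.continuousOn
  have e : η * (∫ t in (0:ℝ)..1, (1 - t) ^ (η - 1) * g t) - c
      = η * ∫ t in (0:ℝ)..1, (1 - t) ^ (η - 1) * (g t - c) := by
    simp_rw [mul_sub]
    rw [intervalIntegral.integral_sub i2 (i1.mul_const c), intervalIntegral.integral_mul_const]
    linear_combination c * ker_val hη
  rw [e, abs_mul, abs_of_pos hη]
  have b : ‖∫ t in (0:ℝ)..1, (1 - t) ^ (η - 1) * (g t - c)‖
      ≤ ∫ t in (0:ℝ)..1, (1 - t) ^ (η - 1) * C := by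
    apply intervalIntegral.norm_integral_le_of_norm_le zero_le_one _ (i1.mul_const C)
    filter_upwards with t ht
    have ht' : 0 ≤ 1 - t := by linarith [ht.2]
    rw [norm_mul, Real.norm_of_nonneg (Real.rpow_nonneg ht' _)]
    exact mul_le_mul_of_nonneg_left (h t ⟨ht.1.le, ht.2⟩) (Real.rpow_nonneg ht' _)
  rw [intervalIntegral.integral_mul_const, Real.norm_eq_abs] at b
  have := mul_le_mul_of_nonneg_left b hη.le
  rwa [← mul_assoc, ker_val hη, one_mul] at this

lemma ker_avg₂ {η₁ η₂ γ₁ γ₂ : ℝ} (hη₁ : 0 < η₁) (hη₂ : 0 < η₂) {G : ℝ → ℝ → ℝ}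
    (hG : Continuous (fun p : ℝ × ℝ => G p.1 p.2)) {M : ℝ} (hM : ∀ a b, |G a b| ≤ M) {c C : ℝ}
    (h : ∀ t ∈ Set.Icc (0:ℝ) 1, ∀ u ∈ Set.Icc (0:ℝ) 1, |G t u - c| ≤ C) :
    |Real.Gamma (η₁ + 1) * Real.Gamma (η₂ + 1) * (∫ t₁ in (0:ℝ)..1, ∫ t₂ in (0:ℝ)..1,
      ((1 - t₁) ^ (η₁ - 1) / Real.Gamma η₁) * ((1 - t₂) ^ (η₂ - 1) / Real.Gamma η₂) *
        G t₁ t₂) - c| ≤ C := by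
  have e : Real.Gamma (η₁ + 1) * Real.Gamma (η₂ + 1) * (∫ t₁ in (0:ℝ)..1, ∫ t₂ in (0:ℝ)..1,
      ((1 - t₁) ^ (η₁ - 1) / Real.Gamma η₁) * ((1 - t₂) ^ (η₂ - 1) / Real.Gamma η₂) *
        G t₁ t₂) = η₁ * ∫ t₁ in (0:ℝ)..1, (1 - t₁) ^ (η₁ - 1) *
          (η₂ * ∫ t₂ in (0:ℝ)..1, (1 - t₂) ^ (η₂ - 1) * G t₁ t₂) := by
    have g1 := (Real.Gamma_pos_of_pos hη₁).ne'
    have g2 := (Real.Gamma_pos_of_pos hη₂).ne'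
    rw [Real.Gamma_add_one hη₁.ne', Real.Gamma_add_one hη₂.ne']
    simp_rw [← intervalIntegral.integral_const_mul]
    refine intervalIntegral.integral_congr fun t _ => ?_
    refine intervalIntegral.integral_congr fun u _ => ?_
    field_simp
  rw [e]
  refine ker_avg hη₁ (continuous_const.mul ?_) fun t ht => ker_avg hη₂ ?_ fun u hu => h t ht u hu
  · refine intervalIntegral.continuous_of_dominated_interval
      (bound := fun u => ‖(1 - u) ^ (η₂ - 1)‖ * M) ?_ ?_ ?_ ?_
    · intro t
      have : IntervalIntegrable (fun u : ℝ => (1 - u) ^ (η₂ - 1) * G t u) volume 0 1 :=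
        (ker_int hη₂).mul_continuousOn
          (hG.comp (continuous_const.prodMk continuous_id)).continuousOn
      exact this.def'.aestronglyMeasurable
    · intro t
      filter_upwards with u _
      rw [norm_mul]
      exact mul_le_mul_of_nonneg_left (hM _ _) (norm_nonneg _)
    · exact (ker_int hη₂).norm.mul_const M
    · filter_upwards with u _
      exact continuous_const.mul (hG.comp (continuous_id.prodMk continuous_const))
  · exact hG.comp (continuous_const.prodMk continuous_id)

lemma node_mem {m j : ℕ} (hj : j ≤ m) {u : ℝ} (hu : u ∈ Set.Icc (0:ℝ) 1) :
    ((j:ℝ) + u) / (m + 1) ∈ Set.Icc (0:ℝ) 1 := by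
  have : (j:ℝ) ≤ m := by exact_mod_cast hj
  have h0 := hu.1
  have h1 := hu.2
  constructor
  · positivity
  · rw [div_le_one (by positivity)]; linarith

lemma node_dist {m j : ℕ} (hm : 1 ≤ m) (hj : j ≤ m) {u : ℝ} (hu : u ∈ Set.Icc (0:ℝ) 1) (z : ℝ) :
    (((j:ℝ) + u) / (m + 1) - z)^2 ≤ 2 * ((j:ℝ) / m - z)^2 + 2 * (1 / (m:ℝ))^2 := by
  have hj' : (j:ℝ) ≤ m := by exact_mod_cast hj
  have hm' : (1:ℝ) ≤ m := by exact_mod_cast hm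
  have h0 := hu.1
  have h1 := hu.2
  have hj0 : (0:ℝ) ≤ j := Nat.cast_nonneg j
  have k : |((j:ℝ) + u) / (m + 1) - j / m| ≤ 1 / m := by
    have : ((j:ℝ) + u) / (m + 1) - j / m = (u - j / m) / (m+1) := by
      field_simp; ring
    rw [this, abs_div, abs_of_pos (by positivity : (0:ℝ) < m + 1)]
    have a : (j:ℝ)/m ≤ 1 := by rw [div_le_one (by linarith)]; exact hj'
    have b : 0 ≤ (j:ℝ)/m := by positivity
    have : |u - j/m| ≤ 1 := by rw [abs_le]; constructor <;> linarith
    exact div_le_div₀ zero_le_one this (by linarith) (by linarith)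
  have k2 : (((j:ℝ) + u) / (m + 1) - j / m)^2 ≤ (1/(m:ℝ))^2 := by
    apply sq_le_sq' <;> linarith [(abs_le.1 k).1, (abs_le.1 k).2]
  nlinarith [sq_nonneg (((j:ℝ) + u) / (m + 1) - j / m - (j/m - z))]

set_option maxHeartbeats 1600000 in
theorem stmt14 (s₁ s₂ : ℕ) (α₁ α₂ η₁ η₂ γ₁ γ₂ : ℝ)
    (hα₁0 : 0 ≤ α₁) (hα₁1 : α₁ ≤ 1) (hα₂0 : 0 ≤ α₂) (hα₂1 : α₂ ≤ 1)
    (hη₁ : 0 < η₁) (hη₂ : 0 < η₂) (hγ₁ : 0 < γ₁) (hγ₂ : 0 < γ₂)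
    (φ : ℝ → ℝ → ℝ)
    (hφ : ContinuousOn (fun p : ℝ × ℝ => φ p.1 p.2) (Set.Icc (0:ℝ) 1 ×ˢ Set.Icc (0:ℝ) 1)) :
    ∀ ε > 0, ∃ N : ℕ, max (max s₁ s₂) 1 ≤ N ∧
      ∀ m₁ m₂, N ≤ m₁ → N ≤ m₂ →
        ∀ z ∈ Set.Icc (0:ℝ) 1, ∀ y ∈ Set.Icc (0:ℝ) 1,
          |Rop₂ m₁ m₂ s₁ s₂ α₁ α₂ η₁ η₂ γ₁ γ₂ φ z y - φ z y| < ε := by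
  intro ε hε
  have hcomp : IsCompact (Set.Icc (0:ℝ) 1 ×ˢ Set.Icc (0:ℝ) 1) := isCompact_Icc.prod isCompact_Icc
  obtain ⟨M, hM⟩ := hcomp.exists_bound_of_continuousOn hφ
  have hM' : ∀ a ∈ Set.Icc (0:ℝ) 1, ∀ b ∈ Set.Icc (0:ℝ) 1, |φ a b| ≤ M :=
    fun a ha b hb => hM (a, b) ⟨ha, hb⟩
  have hM0 : 0 ≤ M := (abs_nonneg _).trans (hM' 0 (by simp) 0 (by simp))
  have huc := hcomp.uniformContinuousOn_of_continuous hφ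
  obtain ⟨r, hr, hur⟩ := Metric.uniformContinuousOn_iff.1 huc (ε/16) (by positivity)
  set A : ℝ := 2 * M / r^2 with hA
  have hA0 : 0 ≤ A := by positivity
  have quad : ∀ a ∈ Set.Icc (0:ℝ) 1, ∀ b ∈ Set.Icc (0:ℝ) 1, ∀ z ∈ Set.Icc (0:ℝ) 1,
      ∀ y ∈ Set.Icc (0:ℝ) 1, |φ a b - φ z y| ≤ ε/16 + A * ((a-z)^2 + (b-y)^2) := by
    intro a ha b hb z hz y hy
    by_cases hd : dist (a,b) (z,y) < r
    · have := hur (a,b) ⟨ha, hb⟩ (z,y) ⟨hz, hy⟩ hd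
      rw [Real.dist_eq] at this
      have : 0 ≤ A * ((a-z)^2 + (b-y)^2) := by positivity
      simp only at *
      linarith
    · have hd' : r^2 ≤ (a-z)^2 + (b-y)^2 := by
        push Not at hd
        rw [Prod.dist_eq, le_max_iff] at hd
        simp only [Real.dist_eq] at hd
        rcases hd with hd | hd
        · have := pow_le_pow_left₀ hr.le hd 2
          rw [sq_abs] at this
          nlinarith [sq_nonneg (b-y)]
        · have := pow_le_pow_left₀ hr.le hd 2
          rw [sq_abs] at this
          nlinarith [sq_nonneg (a-z)]
      have h2 : 2 * M ≤ A * ((a-z)^2 + (b-y)^2) := by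
        calc 2 * M = A * r^2 := by rw [hA]; field_simp
          _ ≤ _ := mul_le_mul_of_nonneg_left hd' hA0
      have := abs_sub (φ a b) (φ z y)
      linarith [hM' a ha b hb, hM' z hz y hy]
  set δ : ℝ := min 1 (ε / (4 * (4 * A + 3 * M + 1))) with hδ
  have hδ0 : 0 < δ := lt_min one_pos (by positivity)
  have hδ1 : δ ≤ 1 := min_le_left _ _
  have hδ2 : δ * (4 * A + 3 * M + 1) ≤ ε / 4 := by
    have : δ ≤ ε / (4 * (4 * A + 3 * M + 1)) := min_le_right _ _
    rw [le_div_iff₀ (by positivity)] at this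
    linarith
  obtain ⟨N₁, hN₁⟩ := q_unif s₁ hα₁0 hα₁1 hδ0
  obtain ⟨N₂, hN₂⟩ := q_unif s₂ hα₂0 hα₂1 hδ0
  refine ⟨max (max (max s₁ s₂) 1) (max N₁ N₂), le_max_left _ _, ?_⟩
  intro m₁ m₂ hm₁ hm₂ z hz y hy
  simp only [max_le_iff] at hm₁ hm₂
  obtain ⟨p₁, S₁, D₁⟩ := hN₁ m₁ hm₁.2.1 z hz
  obtain ⟨p₂, S₂, D₂⟩ := hN₂ m₂ hm₂.2.2 y hy
  set w₁ := qbasis m₁ s₁ α₁ z with hw₁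
  set w₂ := qbasis m₂ s₂ α₂ y with hw₂
  set d₁ : ℕ → ℝ := fun j => 2 * ((j:ℝ) / m₁ - z)^2 + 2 * (1 / (m₁:ℝ))^2 with hd₁
  set d₂ : ℕ → ℝ := fun j => 2 * ((j:ℝ) / m₂ - y)^2 + 2 * (1 / (m₂:ℝ))^2 with hd₂
  change ∑ j ∈ Finset.range (m₁ + 1), w₁ j * d₁ j ≤ δ at D₁
  change ∑ j ∈ Finset.range (m₂ + 1), w₂ j * d₂ j ≤ δ at D₂
  -- the extended function
  let pr : ℝ → ℝ := fun t => (Set.projIcc (0:ℝ) 1 zero_le_one t : ℝ)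
  have prc : Continuous pr := continuous_subtype_val.comp continuous_projIcc
  have prm : ∀ t, pr t ∈ Set.Icc (0:ℝ) 1 := fun t => (Set.projIcc (0:ℝ) 1 zero_le_one t).2
  have pre : ∀ t ∈ Set.Icc (0:ℝ) 1, pr t = t := fun t ht => by
    simp only [pr]; rw [Set.projIcc_of_mem zero_le_one ht]
  have ψc : Continuous (fun p : ℝ × ℝ => φ (pr p.1) (pr p.2)) := by
    have := hφ.comp_continuous (f := fun p : ℝ × ℝ => (pr p.1, pr p.2))
      ((prc.comp continuous_fst).prodMk (prc.comp continuous_snd)) (fun p => ⟨prm _, prm _⟩)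
    exact this
  let J : ℕ → ℕ → ℝ := fun j₁ j₂ => ∫ t₁ in (0:ℝ)..1, ∫ t₂ in (0:ℝ)..1,
          ((1 - t₁) ^ (η₁ - 1) / Real.Gamma η₁) * ((1 - t₂) ^ (η₂ - 1) / Real.Gamma η₂) *
            φ (((j₁ : ℝ) + t₁ ^ γ₁) / (m₁ + 1)) (((j₂ : ℝ) + t₂ ^ γ₂) / (m₂ + 1))
  have pw : ∀ γ : ℝ, 0 < γ → ∀ t ∈ Set.Icc (0:ℝ) 1, t ^ γ ∈ Set.Icc (0:ℝ) 1 := fun γ hγ t ht =>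
    ⟨Real.rpow_nonneg ht.1 _, Real.rpow_le_one ht.1 ht.2 hγ.le⟩
  have hJ : ∀ j₁ ∈ Finset.range (m₁+1), ∀ j₂ ∈ Finset.range (m₂+1),
      |Real.Gamma (η₁ + 1) * Real.Gamma (η₂ + 1) * J j₁ j₂ - φ z y|
        ≤ ε/16 + A * (d₁ j₁ + d₂ j₂) := by
    intro j₁ hj₁ j₂ hj₂
    have hj₁' : j₁ ≤ m₁ := by simpa [Nat.lt_succ_iff] using hj₁
    have hj₂' : j₂ ≤ m₂ := by simpa [Nat.lt_succ_iff] using hj₂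
    let G : ℝ → ℝ → ℝ := fun t u =>
      φ (pr (((j₁ : ℝ) + t ^ γ₁) / (m₁ + 1))) (pr (((j₂ : ℝ) + u ^ γ₂) / (m₂ + 1)))
    have hGc : Continuous (fun p : ℝ × ℝ => G p.1 p.2) := by
      have c1 : Continuous (fun t : ℝ => ((j₁ : ℝ) + t ^ γ₁) / (m₁ + 1)) :=
        (continuous_const.add (Real.continuous_rpow_const hγ₁.le)).div_const _
      have c2 : Continuous (fun t : ℝ => ((j₂ : ℝ) + t ^ γ₂) / (m₂ + 1)) :=
        (continuous_const.add (Real.continuous_rpow_const hγ₂.le)).div_const _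
      exact ψc.comp ((c1.comp continuous_fst).prodMk (c2.comp continuous_snd))
    have hJG : J j₁ j₂ = ∫ t₁ in (0:ℝ)..1, ∫ t₂ in (0:ℝ)..1,
          ((1 - t₁) ^ (η₁ - 1) / Real.Gamma η₁) * ((1 - t₂) ^ (η₂ - 1) / Real.Gamma η₂) *
            G t₁ t₂ := by
      refine intervalIntegral.integral_congr fun t ht => ?_
      refine intervalIntegral.integral_congr fun u hu => ?_
      rw [Set.uIcc_of_le zero_le_one] at ht hu
      simp only [G]
      rw [pre _ (node_mem hj₁' (pw γ₁ hγ₁ t ht)), pre _ (node_mem hj₂' (pw γ₂ hγ₂ u hu))]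
    rw [hJG]
    refine ker_avg₂ (γ₁ := γ₁) (γ₂ := γ₂) hη₁ hη₂ hGc (M := M)
      (fun a b => hM' _ (prm _) _ (prm _)) ?_
    intro t ht u hu
    simp only [G]
    have n1 := node_mem hj₁' (pw γ₁ hγ₁ t ht)
    have n2 := node_mem hj₂' (pw γ₂ hγ₂ u hu)
    rw [pre _ n1, pre _ n2]
    refine (quad _ n1 _ n2 z hz y hy).trans ?_
    have a1 := node_dist hm₁.1.2 hj₁' (pw γ₁ hγ₁ t ht) z
    have a2 := node_dist hm₂.1.2 hj₂' (pw γ₂ hγ₂ u hu) y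
    simp only [hd₁, hd₂]
    gcongr
  set c := φ z y with hc
  set T₁ := ∑ j ∈ Finset.range (m₁ + 1), w₁ j with hT₁
  set T₂ := ∑ j ∈ Finset.range (m₂ + 1), w₂ j with hT₂
  set E₁ := ∑ j ∈ Finset.range (m₁ + 1), w₁ j * d₁ j with hE₁
  set E₂ := ∑ j ∈ Finset.range (m₂ + 1), w₂ j * d₂ j with hE₂
  set Γ2 := Real.Gamma (η₁ + 1) * Real.Gamma (η₂ + 1) with hΓ2
  have R : Rop₂ m₁ m₂ s₁ s₂ α₁ α₂ η₁ η₂ γ₁ γ₂ φ z y - c =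
      ∑ j₁ ∈ Finset.range (m₁ + 1), ∑ j₂ ∈ Finset.range (m₂ + 1),
        w₁ j₁ * w₂ j₂ * (Γ2 * J j₁ j₂ - c) + c * (T₁ * T₂ - 1) := by
    have h1 : Rop₂ m₁ m₂ s₁ s₂ α₁ α₂ η₁ η₂ γ₁ γ₂ φ z y = Γ2 *
      ∑ j₁ ∈ Finset.range (m₁ + 1), ∑ j₂ ∈ Finset.range (m₂ + 1), w₁ j₁ * w₂ j₂ * J j₁ j₂ := rfl
    have h2 : T₁ * T₂ = ∑ j₁ ∈ Finset.range (m₁ + 1), ∑ j₂ ∈ Finset.range (m₂ + 1),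
        w₁ j₁ * w₂ j₂ := Finset.sum_mul_sum _ _ _ _
    have h3 : ∑ j₁ ∈ Finset.range (m₁ + 1), ∑ j₂ ∈ Finset.range (m₂ + 1),
        w₁ j₁ * w₂ j₂ * (Γ2 * J j₁ j₂ - c) = Γ2 *
      ∑ j₁ ∈ Finset.range (m₁ + 1), ∑ j₂ ∈ Finset.range (m₂ + 1), w₁ j₁ * w₂ j₂ * J j₁ j₂
        - c * ∑ j₁ ∈ Finset.range (m₁ + 1), ∑ j₂ ∈ Finset.range (m₂ + 1), w₁ j₁ * w₂ j₂ := by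
      simp_rw [Finset.mul_sum]
      simp_rw [← Finset.sum_sub_distrib]
      refine Finset.sum_congr rfl fun i _ => Finset.sum_congr rfl fun j _ => by ring
    rw [h1, h3, h2]; ring
  have B : |∑ j₁ ∈ Finset.range (m₁ + 1), ∑ j₂ ∈ Finset.range (m₂ + 1),
        w₁ j₁ * w₂ j₂ * (Γ2 * J j₁ j₂ - c)| ≤ ε/16 * (T₁ * T₂) + A * (E₁ * T₂ + T₁ * E₂) := by
    have h4 : ε/16 * (T₁ * T₂) + A * (E₁ * T₂ + T₁ * E₂) =
        ∑ j₁ ∈ Finset.range (m₁ + 1), ∑ j₂ ∈ Finset.range (m₂ + 1),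
          w₁ j₁ * w₂ j₂ * (ε/16 + A * (d₁ j₁ + d₂ j₂)) := by
      rw [hT₁, hT₂, hE₁, hE₂]
      simp_rw [Finset.sum_mul_sum, ← Finset.sum_add_distrib, Finset.mul_sum,
        ← Finset.sum_add_distrib]
      refine Finset.sum_congr rfl fun i _ => Finset.sum_congr rfl fun j _ => by ring
    rw [h4]
    refine (Finset.abs_sum_le_sum_abs _ _).trans (Finset.sum_le_sum fun i hi => ?_)
    refine (Finset.abs_sum_le_sum_abs _ _).trans (Finset.sum_le_sum fun j hj => ?_)
    have hp := mul_nonneg (p₁ i) (p₂ j)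
    rw [abs_mul, abs_of_nonneg hp]
    exact mul_le_mul_of_nonneg_left (hJ i hi j hj) hp
  have hcM : |c| ≤ M := hM' z hz y hy
  have T10 : 0 ≤ T₁ := Finset.sum_nonneg fun i _ => p₁ i
  have T20 : 0 ≤ T₂ := Finset.sum_nonneg fun i _ => p₂ i
  have T12 : T₁ ≤ 2 := by linarith [(abs_le.1 S₁).2]
  have T22 : T₂ ≤ 2 := by linarith [(abs_le.1 S₂).2]
  have TT : T₁ * T₂ ≤ 4 := by nlinarith
  have X1 : E₁ * T₂ ≤ 2 * δ := by nlinarith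
  have X2 : T₁ * E₂ ≤ 2 * δ := by nlinarith
  have Y : |T₁ * T₂ - 1| ≤ 3 * δ := by
    have : T₁ * T₂ - 1 = (T₁ - 1) * T₂ + (T₂ - 1) := by ring
    rw [this]
    refine (abs_add_le _ _).trans ?_
    rw [abs_mul, abs_of_nonneg T20]
    nlinarith [abs_nonneg (T₁ - 1)]
  have Z : |c * (T₁ * T₂ - 1)| ≤ M * (3 * δ) := by
    rw [abs_mul]; exact mul_le_mul hcM Y (abs_nonneg _) hM0
  rw [R]
  have W : A * (E₁ * T₂ + T₁ * E₂) ≤ A * (4 * δ) :=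
    mul_le_mul_of_nonneg_left (by linarith) hA0
  have := abs_add_le (∑ j₁ ∈ Finset.range (m₁ + 1), ∑ j₂ ∈ Finset.range (m₂ + 1),
        w₁ j₁ * w₂ j₂ * (Γ2 * J j₁ j₂ - c)) (c * (T₁ * T₂ - 1))
  nlinarith
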